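/- Let d ≥ 2 and let I = [0,2] × [0,1]^{d−1}. For the prism partition Ω_\ = (Ω_{1,\}, Ω_{2,\}) of I with Ω_{1,\} = {(x_1,x_2) : x_1 ∈ [0,2], 0 ≤ x_2 ≤ 1 − x_1/2} × [0,1]^{d−2} and Ω_{2,\} = {(x_1,x_2) ∈ [0,2]×[0,1] : x_2 ≥ 1 − x_1/2} × [0,1]^{d−2}, the stratified sample satisfies 8 · E L2²(P_{Ω_\}) = 4·2^{−d} − (27/5)·3^{−d}. -/

import Mathlib

open MeasureTheory ProbabilityTheory

noncomputable section

namespace StratifiedSampling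

variable {d : ℕ} {ι : Type} [Fintype ι]

/-- Lebesgue volume of a subset of `ℝ^d` as a real number. -/
def vol (s : Set (Fin d → ℝ)) : ℝ := (volume s).toReal

/-- Number of points of the configuration `p` that lie in the lower box `(-∞, x]`. -/
def countIn (p : ι → (Fin d → ℝ)) (x : Fin d → ℝ) : ℝ :=
  ∑ i, Set.indicator (Set.Iic x) (fun _ => (1 : ℝ)) (p i)

/-- Discrepancy function of the point configuration `p` in the set `K`:
`d_P(x) = #(P ∩ (-∞,x])/N − |K ∩ (-∞,x]|/|K|`. -/
def discrep (K : Set (Fin d → ℝ)) (p : ι → (Fin d → ℝ)) (x : Fin d → ℝ) : ℝ :=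
  countIn p x / (Fintype.card ι : ℝ) - vol (K ∩ Set.Iic x) / vol K

/-- Joint distribution of the stratified sample associated with the family `Ω`:
the points are independent and the `i`-th point is uniformly distributed on `Ω i`. -/
def stratDist (Ω : ι → Set (Fin d → ℝ)) : Measure (ι → (Fin d → ℝ)) :=
  Measure.pi fun i => ProbabilityTheory.cond volume (Ω i)

/-- Mean squared `L2`-discrepancy of the stratified sample from the family `Ω` in `K`:
`E L2²(P_Ω) = E[(1/|K|) ∫_K d_{P_Ω}(x)² dx]`. -/
def meanL2sq (K : Set (Fin d → ℝ)) (Ω : ι → Set (Fin d → ℝ)) : ℝ :=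
  ∫ p, ((1 / vol K) * ∫ x in K, (discrep K p x) ^ 2) ∂(stratDist Ω)

/-- `Ω` is a partition of `K`: measurable sets of positive volume whose union
is `K` and whose distinct members have disjoint interiors. -/
structure IsPartition (K : Set (Fin d → ℝ)) (Ω : ι → Set (Fin d → ℝ)) : Prop where
  measurableSet : ∀ i, MeasurableSet (Ω i)
  vol_pos : ∀ i, 0 < volume (Ω i)
  iUnion_eq : (⋃ i, Ω i) = K
  disjoint_interiors : ∀ i j, i ≠ j → interior (Ω i) ∩ interior (Ω j) = ∅

/-- All members of `Ω` have the same volume. -/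
def IsEquivolume (Ω : ι → Set (Fin d → ℝ)) : Prop :=
  ∀ i j, volume (Ω i) = volume (Ω j)

/-- `q_i(x) = |Ω_i ∩ (-∞,x]| / |Ω_i|`. -/
def qfun (Ω : ι → Set (Fin d → ℝ)) (i : ι) (x : Fin d → ℝ) : ℝ :=
  vol (Ω i ∩ Set.Iic x) / vol (Ω i)

end StratifiedSampling

namespace StratifiedSampling

/-- The box `I = [0,2] × [0,1]^{d−1}`. -/
def boxI (d : ℕ) : Set (Fin d → ℝ) :=
  Set.Icc 0 (fun k => if (k : ℕ) = 0 then 2 else 1)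

/-- The lower prism `{(x₁,x₂) : x₁ ∈ [0,2], 0 ≤ x₂ ≤ 1 − x₁/2} × [0,1]^{d−2}`. -/
def prismLower (d : ℕ) (hd : 2 ≤ d) : Set (Fin d → ℝ) :=
  {x | x ∈ boxI d ∧ x ⟨1, by omega⟩ ≤ 1 - x ⟨0, by omega⟩ / 2}

/-- The upper prism `{(x₁,x₂) ∈ [0,2]×[0,1] : x₂ ≥ 1 − x₁/2} × [0,1]^{d−2}`. -/
def prismUpper (d : ℕ) (hd : 2 ≤ d) : Set (Fin d → ℝ) :=
  {x | x ∈ boxI d ∧ 1 - x ⟨0, by omega⟩ / 2 ≤ x ⟨1, by omega⟩}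

section Expectation

variable {d : ℕ} {ι : Type} [Fintype ι]

lemma countIn_nonneg (p : ι → (Fin d → ℝ)) (x : Fin d → ℝ) : 0 ≤ countIn p x :=
  Finset.sum_nonneg fun _ _ => Set.indicator_nonneg (fun _ _ => zero_le_one) _

lemma countIn_le_card (p : ι → (Fin d → ℝ)) (x : Fin d → ℝ) :
    countIn p x ≤ Fintype.card ι := by
  have h := Finset.sum_le_card_nsmul (Finset.univ : Finset ι)
    (fun i => Set.indicator (Set.Iic x) (fun _ => (1 : ℝ)) (p i)) 1
    fun i _ => Set.indicator_le_self' (fun _ _ => zero_le_one) _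
  simpa [countIn] using h

lemma abs_discrep_le_one {K : Set (Fin d → ℝ)} (hK : volume K ≠ ⊤)
    (p : ι → (Fin d → ℝ)) (x : Fin d → ℝ) : |discrep K p x| ≤ 1 := by
  have h1 : 0 ≤ countIn p x / (Fintype.card ι : ℝ) :=
    div_nonneg (countIn_nonneg p x) (Nat.cast_nonneg _)
  have h2 : countIn p x / (Fintype.card ι : ℝ) ≤ 1 :=
    div_le_one_of_le₀ (countIn_le_card p x) (Nat.cast_nonneg _)
  have h3 : 0 ≤ vol (K ∩ Set.Iic x) / vol K :=
    div_nonneg ENNReal.toReal_nonneg ENNReal.toReal_nonneg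
  have h4 : vol (K ∩ Set.Iic x) / vol K ≤ 1 :=
    div_le_one_of_le₀ (ENNReal.toReal_mono hK (measure_mono Set.inter_subset_left))
      ENNReal.toReal_nonneg
  rw [discrep, abs_le]
  constructor <;> linarith

lemma measurable_vol_inter_Iic {K : Set (Fin d → ℝ)} (hK : MeasurableSet K) :
    Measurable fun x => vol (K ∩ Set.Iic x) := by
  have hs : MeasurableSet {z : (Fin d → ℝ) × (Fin d → ℝ) | z.2 ∈ K ∧ z.2 ≤ z.1} :=
    (measurable_snd hK).inter (measurableSet_le measurable_snd measurable_fst)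
  exact (measurable_measure_prodMk_left (ν := volume) hs).ennreal_toReal

lemma measurable_discrep {K : Set (Fin d → ℝ)} (hK : MeasurableSet K) :
    Measurable fun z : (ι → (Fin d → ℝ)) × (Fin d → ℝ) => discrep K z.1 z.2 := by
  refine Measurable.sub (Measurable.div_const (Finset.measurable_sum _ fun i _ => ?_) _)
    (((measurable_vol_inter_Iic hK).comp measurable_snd).div_const _)
  have hs : MeasurableSet {z : (ι → (Fin d → ℝ)) × (Fin d → ℝ) | z.1 i ≤ z.2} :=
    measurableSet_le ((measurable_pi_apply i).comp measurable_fst) measurable_snd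
  exact (measurable_const (a := (1 : ℝ))).indicator hs

lemma meanL2sq_eq_integral_expectation {K : Set (Fin d → ℝ)} (hK : MeasurableSet K)
    (hK' : volume K ≠ ⊤) (Ω : ι → Set (Fin d → ℝ)) [IsFiniteMeasure (stratDist Ω)] :
    meanL2sq K Ω = 1 / vol K * ∫ x in K, ∫ p, discrep K p x ^ 2 ∂(stratDist Ω) := by
  have : IsFiniteMeasure (volume.restrict K) := ⟨by simpa using hK'.lt_top⟩
  rw [meanL2sq, integral_const_mul, integral_integral_swap]
  refine Integrable.of_bound ((measurable_discrep hK).pow_const 2).aestronglyMeasurable 1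
    (Filter.Eventually.of_forall fun z => ?_)
  have h := abs_discrep_le_one hK' z.1 z.2
  simpa [Function.uncurry] using h

/-- The second moment of the centred number of points in a lower box, for two independent points. -/
lemma integral_sq_countIn_sub (μ : Fin 2 → Measure (Fin d → ℝ)) [∀ i, IsProbabilityMeasure (μ i)]
    (x : Fin d → ℝ) :
    ∫ p, (countIn p x - ((μ 0).real (Set.Iic x) + (μ 1).real (Set.Iic x))) ^ 2 ∂(Measure.pi μ) =
      (μ 0).real (Set.Iic x) + (μ 1).real (Set.Iic x)
        - (μ 0).real (Set.Iic x) ^ 2 - (μ 1).real (Set.Iic x) ^ 2 := by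
  set f : (Fin d → ℝ) → ℝ := Set.indicator (Set.Iic x) (fun _ => 1) with hf
  have hfm : Measurable f := measurable_const.indicator measurableSet_Iic
  have hf01 : ∀ y, f y = 0 ∨ f y = 1 := fun y => by
    by_cases hy : y ∈ Set.Iic x <;> simp [hf, hy]
  have hfint : ∀ i, ∫ y, f y ∂(μ i) = (μ i).real (Set.Iic x) := fun i =>
    integral_indicator_one measurableSet_Iic
  have hi : ∀ i, Integrable (fun p : Fin 2 → (Fin d → ℝ) => f (p i)) (Measure.pi μ) := fun i =>
    Integrable.of_bound (hfm.comp (measurable_pi_apply i)).aestronglyMeasurable 1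
      (Filter.Eventually.of_forall fun p => by rcases hf01 (p i) with h | h <;> simp [h])
  have hij : Integrable (fun p : Fin 2 → (Fin d → ℝ) => f (p 0) * f (p 1)) (Measure.pi μ) :=
    Integrable.of_bound ((hfm.comp (measurable_pi_apply 0)).mul
        (hfm.comp (measurable_pi_apply 1))).aestronglyMeasurable 1
      (Filter.Eventually.of_forall fun p => by
        rcases hf01 (p 0) with h | h <;> rcases hf01 (p 1) with h' | h' <;> simp [h, h'])
  have hmarg : ∀ i, ∫ p, f (p i) ∂(Measure.pi μ) = (μ i).real (Set.Iic x) := fun i => by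
    rw [integral_comp_eval hfm.aestronglyMeasurable, hfint]
  have hprod : ∫ p, f (p 0) * f (p 1) ∂(Measure.pi μ) =
      (μ 0).real (Set.Iic x) * (μ 1).real (Set.Iic x) := by
    have h := integral_fintype_prod_eq_prod (μ := μ) (fun _ => f)
    simpa only [Fin.prod_univ_two, hfint] using h
  set v := (μ 0).real (Set.Iic x) + (μ 1).real (Set.Iic x) with hv
  have hexp : ∀ p : Fin 2 → (Fin d → ℝ), (countIn p x - v) ^ 2 =
      (1 - 2 * v) * f (p 0) + (1 - 2 * v) * f (p 1) + 2 * (f (p 0) * f (p 1)) + v ^ 2 := by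
    intro p
    have hc : countIn p x = f (p 0) + f (p 1) := by simp [countIn, hf, Fin.sum_univ_two]
    rw [hc]
    rcases hf01 (p 0) with h | h <;> rcases hf01 (p 1) with h' | h' <;> rw [h, h'] <;> ring
  simp_rw [hexp]
  have h0 (i : Fin 2) : Integrable (fun p : Fin 2 → (Fin d → ℝ) => (1 - 2 * v) * f (p i))
      (Measure.pi μ) := (hi i).const_mul _
  have h01 : Integrable (fun p : Fin 2 → (Fin d → ℝ) =>
      (1 - 2 * v) * f (p 0) + (1 - 2 * v) * f (p 1)) (Measure.pi μ) := (h0 0).add (h0 1)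
  have h2 : Integrable (fun p : Fin 2 → (Fin d → ℝ) => 2 * (f (p 0) * f (p 1)))
      (Measure.pi μ) := hij.const_mul _
  have h012 : Integrable (fun p : Fin 2 → (Fin d → ℝ) =>
      (1 - 2 * v) * f (p 0) + (1 - 2 * v) * f (p 1) + 2 * (f (p 0) * f (p 1)))
      (Measure.pi μ) := h01.add h2
  rw [integral_add h012 (integrable_const _), integral_add h01 h2, integral_add (h0 0) (h0 1)]
  simp only [integral_const_mul, hmarg, hprod, integral_const, probReal_univ, smul_eq_mul]
  rw [hv]
  ring

/-- For two strata of unit volume whose union has volume two, the mean squared `L2`-discrepancy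
is an integral of the local volumes of the strata. -/
lemma eight_meanL2sq_of_two_unit_strata {K A B : Set (Fin d → ℝ)} (hK : MeasurableSet K)
    (hKv : vol K = 2) (hA : MeasurableSet A) (hB : MeasurableSet B) (hAv : vol A = 1)
    (hBv : vol B = 1)
    (hAB : ∀ x ∈ K, vol (A ∩ Set.Iic x) + vol (B ∩ Set.Iic x) = vol (K ∩ Set.Iic x)) :
    8 * meanL2sq K ![A, B] = ∫ x in K,
      (vol (K ∩ Set.Iic x) - vol (A ∩ Set.Iic x) ^ 2 - vol (B ∩ Set.Iic x) ^ 2) := by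
  have hne : ∀ {S : Set (Fin d → ℝ)} {c : ℝ}, c ≠ 0 → vol S = c →
      volume S ≠ 0 ∧ volume S ≠ ⊤ := by
    rintro S c hc rfl
    exact ENNReal.toReal_ne_zero.1 hc
  have hcond : ∀ {S : Set (Fin d → ℝ)} (x), MeasurableSet S → vol S = 1 →
      (ProbabilityTheory.cond volume S).real (Set.Iic x) = vol (S ∩ Set.Iic x) := by
    intro S x hS hv
    have h1 : volume S = 1 := (ENNReal.toReal_eq_one_iff _).1 hv
    rw [measureReal_def, cond_apply hS, h1, inv_one, one_mul, vol]
  have hprob : ∀ i : Fin 2, IsProbabilityMeasure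
      (ProbabilityTheory.cond volume ((![A, B] : Fin 2 → Set (Fin d → ℝ)) i)) := by
    intro i
    fin_cases i
    · exact cond_isProbabilityMeasure_of_finite (hne one_ne_zero hAv).1 (hne one_ne_zero hAv).2
    · exact cond_isProbabilityMeasure_of_finite (hne one_ne_zero hBv).1 (hne one_ne_zero hBv).2
  have : IsProbabilityMeasure (stratDist ![A, B]) := by
    unfold stratDist
    infer_instance
  rw [meanL2sq_eq_integral_expectation hK (hne two_ne_zero hKv).2, hKv, ← mul_assoc,
    ← integral_const_mul]
  refine setIntegral_congr_fun hK fun x hx => ?_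
  have h := integral_sq_countIn_sub
    (fun i : Fin 2 => ProbabilityTheory.cond volume ((![A, B] : Fin 2 → Set (Fin d → ℝ)) i)) x
  simp only [Matrix.cons_val_zero, Matrix.cons_val_one, hcond x hA hAv, hcond x hB hBv,
    hAB x hx] at h
  have hd : ∀ p : Fin 2 → (Fin d → ℝ), discrep K p x ^ 2 =
      1 / 4 * (countIn p x - vol (K ∩ Set.Iic x)) ^ 2 := fun p => by
    rw [discrep, hKv, Fintype.card_fin]
    push_cast
    ring
  simp_rw [hd]
  rw [integral_const_mul, stratDist, h]
  ring

end Expectation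

section Splitting

/-- Separation of the first two coordinates from the remaining ones. -/
def splitTwo (n : ℕ) : (Fin (n + 2) → ℝ) ≃ᵐ (ℝ × ℝ) × (Fin n → ℝ) :=
  ((MeasurableEquiv.piFinSuccAbove (fun _ => ℝ) 0).trans
    (MeasurableEquiv.prodCongr (MeasurableEquiv.refl ℝ)
      (MeasurableEquiv.piFinSuccAbove (fun _ => ℝ) 0))).trans MeasurableEquiv.prodAssoc.symm

lemma splitTwo_apply (n : ℕ) (x : Fin (n + 2) → ℝ) :
    splitTwo n x = ((x 0, x 1), fun k => x k.succ.succ) := rfl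

lemma volume_preserving_splitTwo (n : ℕ) : MeasurePreserving (splitTwo n) := by
  have h1 := volume_preserving_piFinSuccAbove (fun _ : Fin (n + 2) => ℝ) 0
  have h2 := volume_preserving_piFinSuccAbove (fun _ : Fin (n + 1) => ℝ) 0
  have h3 : MeasurePreserving (MeasurableEquiv.prodAssoc : (ℝ × ℝ) × (Fin n → ℝ) ≃ᵐ _) :=
    volume_preserving_prodAssoc
  exact (h3.symm _).comp (((MeasurePreserving.id (volume : Measure ℝ)).prod h2).comp h1)

lemma vol_splitTwo_preimage {n : ℕ} (T : Set (ℝ × ℝ)) {b : Fin n → ℝ} (hb : ∀ k, 0 ≤ b k) :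
    vol (splitTwo n ⁻¹' (T ×ˢ Set.Icc 0 b)) = (volume T).toReal * ∏ k, b k := by
  rw [vol, (volume_preserving_splitTwo n).measure_preimage_equiv, Measure.volume_eq_prod,
    Measure.prod_prod, Real.volume_Icc_pi, ENNReal.toReal_mul, ENNReal.toReal_prod]
  simp [ENNReal.toReal_ofReal (hb _)]

lemma setIntegral_splitTwo_preimage {n : ℕ} (T : Set (ℝ × ℝ)) (A : Set ℝ) (F : ℝ → ℝ → ℝ)
    (g : ℝ → ℝ) :
    ∫ x in splitTwo n ⁻¹' (T ×ˢ Set.univ.pi fun _ => A),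
        F (x 0) (x 1) * ∏ k : Fin n, g (x k.succ.succ)
      = (∫ z in T, F z.1 z.2) * (∫ t in A, g t) ^ n := by
  have h := (volume_preserving_splitTwo n).setIntegral_preimage_emb
    (splitTwo n).measurableEmbedding
    (fun z => F z.1.1 z.1.2 * ∏ k, g (z.2 k)) (T ×ˢ Set.univ.pi fun _ => A)
  simp only [splitTwo_apply] at h
  rw [h, Measure.volume_eq_prod,
    setIntegral_prod_mul (fun z : ℝ × ℝ => F z.1 z.2) (fun y : Fin n → ℝ => ∏ k, g (y k)),
    volume_pi, Measure.restrict_pi_pi, integral_fintype_prod_eq_prod (fun _ => g)]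
  simp

end Splitting

section Planar

lemma toReal_volume_of_slices {S : Set (ℝ × ℝ)} (hS : MeasurableSet S) {a : ℝ} (ha : 0 ≤ a)
    {g : ℝ → ℝ} (hg : Continuous g) (hg0 : ∀ t ∈ Set.Icc 0 a, 0 ≤ g t)
    (hin : ∀ t ∈ Set.Icc 0 a, volume (Prod.mk t ⁻¹' S) = ENNReal.ofReal (g t))
    (hout : ∀ t ∉ Set.Icc 0 a, volume (Prod.mk t ⁻¹' S) = 0) :
    (volume S).toReal = ∫ t in 0..a, g t := by
  have hind : (fun t => volume (Prod.mk t ⁻¹' S)) =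
      Set.indicator (Set.Icc 0 a) fun t => ENNReal.ofReal (g t) := by
    funext t
    by_cases ht : t ∈ Set.Icc 0 a
    · rw [Set.indicator_of_mem ht, hin t ht]
    · rw [Set.indicator_of_notMem ht, hout t ht]
  have hae : 0 ≤ᵐ[volume.restrict (Set.Icc 0 a)] g :=
    (ae_restrict_iff' measurableSet_Icc).2 (Filter.Eventually.of_forall hg0)
  rw [Measure.volume_eq_prod, Measure.prod_apply hS, hind, lintegral_indicator measurableSet_Icc,
    ← ofReal_integral_eq_lintegral_ofReal hg.integrableOn_Icc hae,
    ENNReal.toReal_ofReal (integral_nonneg_of_ae hae), integral_Icc_eq_integral_Ioc,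
    intervalIntegral.integral_of_le ha]

lemma integral_comp_max_zero {φ : ℝ → ℝ → ℝ} (hφ : Continuous (Function.uncurry φ))
    {p q c : ℝ} (hp : p ≤ c) (hq : c ≤ q) {l : ℝ → ℝ} (hl : Continuous l)
    (hneg : ∀ t ≤ c, l t ≤ 0) (hpos : ∀ t ≥ c, 0 ≤ l t) :
    ∫ t in p..q, φ t (max 0 (l t)) = (∫ t in p..c, φ t 0) + ∫ t in c..q, φ t (l t) := by
  have hc : Continuous fun t => φ t (max 0 (l t)) :=
    hφ.comp (continuous_id.prodMk (continuous_const.max hl))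
  rw [← intervalIntegral.integral_add_adjacent_intervals (hc.intervalIntegrable p c)
    (hc.intervalIntegrable c q)]
  congr 1
  · refine intervalIntegral.integral_congr fun t ht => ?_
    rw [Set.uIcc_of_le hp] at ht
    simp only [max_eq_left (hneg t ht.2)]
  · refine intervalIntegral.integral_congr fun t ht => ?_
    rw [Set.uIcc_of_le hq] at ht
    simp only [max_eq_right (hpos t ht.1)]

lemma integral_max_zero_affine {a b : ℝ} (ha : 0 ≤ a) (hb : b ≤ 1) :
    ∫ t in 0..a, max 0 (t / 2 + b - 1) = max 0 (a / 2 + b - 1) ^ 2 := by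
  rcases le_total (a / 2 + b - 1) 0 with h | h
  · rw [max_eq_left h]
    have hz : ∫ t in 0..a, max 0 (t / 2 + b - 1) = ∫ _ in 0..a, (0 : ℝ) := by
      refine intervalIntegral.integral_congr fun t ht => ?_
      rw [Set.uIcc_of_le ha] at ht
      exact max_eq_left (by linarith [ht.2])
    simp [hz]
  · rw [max_eq_right h, integral_comp_max_zero (φ := fun _ u => u) (by fun_prop)
      (c := 2 * (1 - b)) (by linarith) (by linarith) (by fun_prop)
      (fun t ht => by linarith) (fun t ht => by linarith)]
    have hd : ∀ t ∈ Set.uIcc (2 * (1 - b)) a,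
        HasDerivAt (fun t : ℝ => (t / 2 + b - 1) ^ 2) (t / 2 + b - 1) t := fun t _ =>
      HasDerivAt.congr_deriv (((((hasDerivAt_id t).div_const 2).add_const b).sub_const 1).pow 2)
        (by simp; ring)
    rw [intervalIntegral.integral_eq_sub_of_hasDerivAt hd
      ((by fun_prop : Continuous fun t : ℝ => t / 2 + b - 1).intervalIntegrable _ _)]
    simp

lemma toReal_volume_upper_triangle {a b : ℝ} (ha : 0 ≤ a) (ha2 : a ≤ 2) (hb : b ≤ 1) :
    (volume (Set.Icc (0 : ℝ × ℝ) (a, b) ∩ {z | 1 - z.1 / 2 ≤ z.2})).toReal =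
      max 0 (a / 2 + b - 1) ^ 2 := by
  rw [← integral_max_zero_affine ha hb]
  refine toReal_volume_of_slices (measurableSet_Icc.inter
    (measurableSet_le (f := fun z : ℝ × ℝ => 1 - z.1 / 2) (g := fun z => z.2) (by fun_prop)
      (by fun_prop))) ha (g := fun t => max 0 (t / 2 + b - 1)) (by fun_prop)
    (fun t _ => le_max_left _ _) (fun t ht => ?_) fun t ht => ?_
  · have hs : Prod.mk t ⁻¹' (Set.Icc (0 : ℝ × ℝ) (a, b) ∩ {z | 1 - z.1 / 2 ≤ z.2}) =
        Set.Icc (1 - t / 2) b := by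
      ext y
      simp only [Set.mem_preimage, Set.mem_inter_iff, Set.mem_ofPred_eq, Set.mem_Icc,
        Prod.le_def, Prod.fst_zero, Prod.snd_zero]
      exact ⟨fun h => ⟨h.2, h.1.2.2⟩,
        fun h => ⟨⟨⟨ht.1, by linarith [h.1, ht.2]⟩, ht.2, h.2⟩, h.1⟩⟩
    rw [hs, Real.volume_Icc, ENNReal.ofReal_max, ENNReal.ofReal_zero, max_eq_right zero_le]
    congr 1
    ring
  · have hs : Prod.mk t ⁻¹' (Set.Icc (0 : ℝ × ℝ) (a, b) ∩ {z | 1 - z.1 / 2 ≤ z.2}) =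
        ∅ :=
      Set.eq_empty_of_forall_notMem fun y hy => ht ⟨hy.1.1.1, hy.1.2.1⟩
    rw [hs, measure_empty]

lemma toReal_volume_lower_triangle {a b : ℝ} (ha : 0 ≤ a) (ha2 : a ≤ 2) (hb0 : 0 ≤ b)
    (hb : b ≤ 1) :
    (volume (Set.Icc (0 : ℝ × ℝ) (a, b) ∩ {z | z.2 ≤ 1 - z.1 / 2})).toReal =
      a * b - max 0 (a / 2 + b - 1) ^ 2 := by
  have hI : ∫ t in 0..a, (b - max 0 (t / 2 + b - 1)) = a * b - max 0 (a / 2 + b - 1) ^ 2 := by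
    rw [intervalIntegral.integral_sub intervalIntegrable_const
      ((by fun_prop : Continuous fun t : ℝ => max 0 (t / 2 + b - 1)).intervalIntegrable _ _),
      integral_max_zero_affine ha hb]
    simp
  have hmin : ∀ t : ℝ, b - max 0 (t / 2 + b - 1) = min b (1 - t / 2) := fun t => by
    rcases le_total (t / 2 + b - 1) 0 with h | h
    · rw [max_eq_left h, min_eq_left (by linarith), sub_zero]
    · rw [max_eq_right h, min_eq_right (by linarith)]
      ring
  rw [← hI]
  simp_rw [hmin]
  refine toReal_volume_of_slices (measurableSet_Icc.inter
    (measurableSet_le (f := fun z : ℝ × ℝ => z.2) (g := fun z => 1 - z.1 / 2) (by fun_prop)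
      (by fun_prop))) ha (g := fun t => min b (1 - t / 2)) (by fun_prop)
    (fun t ht => le_min hb0 (by linarith [ht.2])) (fun t ht => ?_) fun t ht => ?_
  · have hs : Prod.mk t ⁻¹' (Set.Icc (0 : ℝ × ℝ) (a, b) ∩ {z | z.2 ≤ 1 - z.1 / 2}) =
        Set.Icc 0 (min b (1 - t / 2)) := by
      ext y
      simp only [Set.mem_preimage, Set.mem_inter_iff, Set.mem_ofPred_eq, Set.mem_Icc,
        Prod.le_def, Prod.fst_zero, Prod.snd_zero, le_min_iff]
      exact ⟨fun h => ⟨h.1.1.2, h.1.2.2, h.2⟩, fun h => ⟨⟨⟨ht.1, h.1⟩, ht.2, h.2.1⟩, h.2.2⟩⟩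
    rw [hs, Real.volume_Icc, sub_zero]
  · have hs : Prod.mk t ⁻¹' (Set.Icc (0 : ℝ × ℝ) (a, b) ∩ {z | z.2 ≤ 1 - z.1 / 2}) =
        ∅ :=
      Set.eq_empty_of_forall_notMem fun y hy => ht ⟨hy.1.1.1, hy.1.2.1⟩
    rw [hs, measure_empty]

lemma integral_quadratic_slice {a : ℝ} (ha : 0 ≤ a) (ha2 : a ≤ 2) :
    ∫ b in (0 : ℝ)..1, (-(a * b) ^ 2 + 2 * (a * b) * max 0 (a / 2 + b - 1) ^ 2
        - 2 * (max 0 (a / 2 + b - 1) ^ 2) ^ 2) =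
      -a ^ 2 / 3 + a ^ 4 / 12 - 11 * a ^ 5 / 480 := by
  rw [integral_comp_max_zero (φ := fun b u => -(a * b) ^ 2 + 2 * (a * b) * u ^ 2 - 2 * (u ^ 2) ^ 2)
    (by fun_prop) (c := 1 - a / 2) (by linarith) (by linarith) (by fun_prop)
    (fun t ht => by linarith) (fun t ht => by linarith)]
  have hd1 : ∀ t ∈ Set.uIcc (0 : ℝ) (1 - a / 2), HasDerivAt (fun t : ℝ => -a ^ 2 * t ^ 3 / 3)
      (-(a * t) ^ 2 + 2 * (a * t) * 0 ^ 2 - 2 * (0 ^ 2) ^ 2) t := fun t _ =>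
    HasDerivAt.congr_deriv ((((hasDerivAt_id t).pow 3).const_mul (-a ^ 2)).div_const 3)
      (by simp; ring)
  have hd2 : ∀ t ∈ Set.uIcc (1 - a / 2) 1, HasDerivAt (fun t : ℝ => -a ^ 2 * t ^ 3 / 3
        + 2 * a * ((a / 2 + t - 1) ^ 4 / 4 + (1 - a / 2) * (a / 2 + t - 1) ^ 3 / 3)
        - 2 * (a / 2 + t - 1) ^ 5 / 5)
      (-(a * t) ^ 2 + 2 * (a * t) * (a / 2 + t - 1) ^ 2 - 2 * ((a / 2 + t - 1) ^ 2) ^ 2) t :=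
    fun t _ => by
    have hu := ((hasDerivAt_id t).const_add (a / 2)).sub_const 1
    exact HasDerivAt.congr_deriv (((((hasDerivAt_id t).pow 3).const_mul (-a ^ 2)).div_const 3).add
      ((((hu.pow 4).div_const 4).add (((hu.pow 3).const_mul (1 - a / 2)).div_const 3)).const_mul
        (2 * a)) |>.sub (((hu.pow 5).const_mul 2).div_const 5))
      (by simp; ring)
  rw [intervalIntegral.integral_eq_sub_of_hasDerivAt hd1
      ((by fun_prop : Continuous _).intervalIntegrable _ _),
    intervalIntegral.integral_eq_sub_of_hasDerivAt hd2
      ((by fun_prop : Continuous _).intervalIntegrable _ _)]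
  ring

lemma setIntegral_Icc_prod {F : ℝ → ℝ → ℝ} (hF : Continuous (Function.uncurry F)) {a b : ℝ}
    (ha : 0 ≤ a) (hb : 0 ≤ b) :
    ∫ z in Set.Icc 0 a ×ˢ Set.Icc 0 b, F z.1 z.2 = ∫ s in 0..a, ∫ t in 0..b, F s t := by
  have hint : IntegrableOn (fun z : ℝ × ℝ => F z.1 z.2) (Set.Icc 0 a ×ˢ Set.Icc 0 b)
      (volume.prod volume) :=
    ContinuousOn.integrableOn_compact (isCompact_Icc.prod isCompact_Icc) hF.continuousOn
  rw [Measure.volume_eq_prod, setIntegral_prod _ hint, intervalIntegral.integral_of_le ha,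
    ← integral_Icc_eq_integral_Ioc]
  simp_rw [intervalIntegral.integral_of_le hb, ← integral_Icc_eq_integral_Ioc]

lemma integral_quadratic_part :
    ∫ z in Set.Icc (0 : ℝ) 2 ×ˢ Set.Icc (0 : ℝ) 1,
      (-(z.1 * z.2) ^ 2 + 2 * (z.1 * z.2) * max 0 (z.1 / 2 + z.2 - 1) ^ 2
        - 2 * (max 0 (z.1 / 2 + z.2 - 1) ^ 2) ^ 2) = -(3 / 5) := by
  rw [setIntegral_Icc_prod (F := fun s t => -(s * t) ^ 2 + 2 * (s * t) * max 0 (s / 2 + t - 1) ^ 2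
        - 2 * (max 0 (s / 2 + t - 1) ^ 2) ^ 2) (by fun_prop) zero_le_two zero_le_one]
  have hc : ∫ s in (0 : ℝ)..2, ∫ t in (0 : ℝ)..1,
      (-(s * t) ^ 2 + 2 * (s * t) * max 0 (s / 2 + t - 1) ^ 2
        - 2 * (max 0 (s / 2 + t - 1) ^ 2) ^ 2) =
      ∫ s in (0 : ℝ)..2, (-s ^ 2 / 3 + s ^ 4 / 12 - 11 * s ^ 5 / 480) := by
    refine intervalIntegral.integral_congr fun s hs => ?_
    rw [Set.uIcc_of_le zero_le_two] at hs
    exact integral_quadratic_slice hs.1 hs.2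
  have hd : ∀ s ∈ Set.uIcc (0 : ℝ) 2, HasDerivAt
      (fun s : ℝ => -s ^ 3 / 9 + s ^ 5 / 60 - 11 * s ^ 6 / 2880)
      (-s ^ 2 / 3 + s ^ 4 / 12 - 11 * s ^ 5 / 480) s := fun s _ =>
    HasDerivAt.congr_deriv (((((hasDerivAt_id s).pow 3).neg.div_const 9).add
      (((hasDerivAt_id s).pow 5).div_const 60)).sub
        ((((hasDerivAt_id s).pow 6).const_mul 11).div_const 2880))
      (by simp; ring)
  rw [hc, intervalIntegral.integral_eq_sub_of_hasDerivAt hd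
    ((by fun_prop : Continuous _).intervalIntegrable _ _)]
  norm_num

lemma integral_bilinear_part :
    ∫ z in Set.Icc (0 : ℝ) 2 ×ˢ Set.Icc (0 : ℝ) 1, z.1 * z.2 = 1 := by
  rw [setIntegral_Icc_prod (F := fun s t => s * t) (by fun_prop) zero_le_two zero_le_one]
  have h (s : ℝ) : ∫ t in (0 : ℝ)..1, s * t = s / 2 := by
    rw [intervalIntegral.integral_const_mul, integral_id]
    ring
  simp_rw [h, intervalIntegral.integral_div, integral_id]
  norm_num

end Planar

section Prisms

variable {n : ℕ}

lemma mem_boxI_iff {x : Fin (n + 2) → ℝ} : x ∈ boxI (n + 2) ↔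
    (0 ≤ x 0 ∧ x 0 ≤ 2) ∧ (0 ≤ x 1 ∧ x 1 ≤ 1) ∧
      ∀ k : Fin n, 0 ≤ x k.succ.succ ∧ x k.succ.succ ≤ 1 := by
  simp only [boxI, Set.mem_Icc, Pi.le_def, Fin.forall_fin_succ]
  simp [forall_and]
  tauto

lemma boxI_eq_preimage : boxI (n + 2) = splitTwo n ⁻¹'
    ((Set.Icc 0 2 ×ˢ Set.Icc 0 1) ×ˢ Set.univ.pi fun _ => Set.Icc 0 1) := by
  ext x
  simp [mem_boxI_iff, splitTwo_apply, Pi.le_def, forall_and]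
  tauto

lemma boxI_inter_Iic {x : Fin (n + 2) → ℝ} (hx : x ∈ boxI (n + 2)) :
    boxI (n + 2) ∩ Set.Iic x = splitTwo n ⁻¹'
      (Set.Icc 0 (x 0, x 1) ×ˢ Set.Icc 0 fun k => x k.succ.succ) := by
  ext y
  obtain ⟨h0, h1, h⟩ := mem_boxI_iff.1 hx
  simp only [Set.mem_inter_iff, mem_boxI_iff, Set.mem_Iic, Set.mem_preimage, splitTwo_apply,
    Set.mem_prod, Set.mem_Icc, Prod.le_def, Prod.fst_zero, Prod.snd_zero, Pi.le_def,
    Fin.forall_fin_succ, Pi.zero_apply]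
  constructor
  · rintro ⟨⟨g0, g1, g⟩, l0, l1, l⟩
    exact ⟨⟨⟨g0.1, g1.1⟩, l0, l1⟩, fun k => (g k).1, l⟩
  · rintro ⟨⟨⟨g0, g1⟩, l0, l1⟩, g, l⟩
    exact ⟨⟨⟨g0, l0.trans h0.2⟩, ⟨g1, l1.trans h1.2⟩,
      fun k => ⟨g k, (l k).trans (h k).2⟩⟩, l0, l1, l⟩

lemma prismLower_inter_Iic (hd : 2 ≤ n + 2) {x : Fin (n + 2) → ℝ} (hx : x ∈ boxI (n + 2)) :
    prismLower (n + 2) hd ∩ Set.Iic x = splitTwo n ⁻¹'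
      ((Set.Icc 0 (x 0, x 1) ∩ {z | z.2 ≤ 1 - z.1 / 2}) ×ˢ
        Set.Icc 0 fun k => x k.succ.succ) := by
  have hs : prismLower (n + 2) hd = boxI (n + 2) ∩ {y | y 1 ≤ 1 - y 0 / 2} := rfl
  rw [hs, Set.inter_right_comm, boxI_inter_Iic hx]
  ext y
  simp only [Set.mem_inter_iff, Set.mem_preimage, Set.mem_prod, splitTwo_apply,
    Set.mem_ofPred_eq]
  tauto

lemma prismUpper_inter_Iic (hd : 2 ≤ n + 2) {x : Fin (n + 2) → ℝ} (hx : x ∈ boxI (n + 2)) :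
    prismUpper (n + 2) hd ∩ Set.Iic x = splitTwo n ⁻¹'
      ((Set.Icc 0 (x 0, x 1) ∩ {z | 1 - z.1 / 2 ≤ z.2}) ×ˢ
        Set.Icc 0 fun k => x k.succ.succ) := by
  have hs : prismUpper (n + 2) hd = boxI (n + 2) ∩ {y | 1 - y 0 / 2 ≤ y 1} := rfl
  rw [hs, Set.inter_right_comm, boxI_inter_Iic hx]
  ext y
  simp only [Set.mem_inter_iff, Set.mem_preimage, Set.mem_prod, splitTwo_apply,
    Set.mem_ofPred_eq]
  tauto

lemma vol_boxI_inter_Iic {x : Fin (n + 2) → ℝ} (hx : x ∈ boxI (n + 2)) :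
    vol (boxI (n + 2) ∩ Set.Iic x) = x 0 * x 1 * ∏ k : Fin n, x k.succ.succ := by
  obtain ⟨h0, h1, h⟩ := mem_boxI_iff.1 hx
  rw [boxI_inter_Iic hx, vol_splitTwo_preimage _ fun k => (h k).1]
  have hI : Set.Icc (0 : ℝ × ℝ) (x 0, x 1) = Set.Icc 0 (x 0) ×ˢ Set.Icc 0 (x 1) :=
    (Set.Icc_prod_Icc _ _ _ _).symm
  rw [hI, Measure.volume_eq_prod, Measure.prod_prod, Real.volume_Icc, Real.volume_Icc,
    ENNReal.toReal_mul, sub_zero, sub_zero, ENNReal.toReal_ofReal h0.1,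
    ENNReal.toReal_ofReal h1.1]

lemma vol_prismLower_inter_Iic (hd : 2 ≤ n + 2) {x : Fin (n + 2) → ℝ}
    (hx : x ∈ boxI (n + 2)) : vol (prismLower (n + 2) hd ∩ Set.Iic x) =
      (x 0 * x 1 - max 0 (x 0 / 2 + x 1 - 1) ^ 2) * ∏ k : Fin n, x k.succ.succ := by
  obtain ⟨h0, h1, h⟩ := mem_boxI_iff.1 hx
  rw [prismLower_inter_Iic hd hx, vol_splitTwo_preimage _ fun k => (h k).1,
    toReal_volume_lower_triangle h0.1 h0.2 h1.1 h1.2]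

lemma vol_prismUpper_inter_Iic (hd : 2 ≤ n + 2) {x : Fin (n + 2) → ℝ}
    (hx : x ∈ boxI (n + 2)) : vol (prismUpper (n + 2) hd ∩ Set.Iic x) =
      max 0 (x 0 / 2 + x 1 - 1) ^ 2 * ∏ k : Fin n, x k.succ.succ := by
  obtain ⟨h0, h1, h⟩ := mem_boxI_iff.1 hx
  rw [prismUpper_inter_Iic hd hx, vol_splitTwo_preimage _ fun k => (h k).1,
    toReal_volume_upper_triangle h0.1 h0.2 h1.2]

lemma measurableSet_prismLower (hd : 2 ≤ n + 2) : MeasurableSet (prismLower (n + 2) hd) :=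
  measurableSet_Icc.inter (measurableSet_le (f := fun y : Fin (n + 2) → ℝ => y 1)
    (g := fun y => 1 - y 0 / 2) (by fun_prop) (by fun_prop))

lemma measurableSet_prismUpper (hd : 2 ≤ n + 2) : MeasurableSet (prismUpper (n + 2) hd) :=
  measurableSet_Icc.inter (measurableSet_le (f := fun y : Fin (n + 2) → ℝ => 1 - y 0 / 2)
    (g := fun y => y 1) (by fun_prop) (by fun_prop))

lemma eight_meanL2sq_prism_eq_integral (hd : 2 ≤ n + 2) :
    8 * meanL2sq (boxI (n + 2)) ![prismLower (n + 2) hd, prismUpper (n + 2) hd] =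
      ∫ x in boxI (n + 2), (x 0 * x 1 * ∏ k : Fin n, x k.succ.succ +
        (-(x 0 * x 1) ^ 2 + 2 * (x 0 * x 1) * max 0 (x 0 / 2 + x 1 - 1) ^ 2
          - 2 * (max 0 (x 0 / 2 + x 1 - 1) ^ 2) ^ 2) * ∏ k : Fin n, x k.succ.succ ^ 2) := by
  have hbox : MeasurableSet (boxI (n + 2)) := measurableSet_Icc
  set top : Fin (n + 2) → ℝ := fun k => if (k : ℕ) = 0 then 2 else 1 with htop
  have hmem : top ∈ boxI (n + 2) := by
    rw [mem_boxI_iff]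
    simp [htop]
  have hle : boxI (n + 2) ⊆ Set.Iic top := fun x hx => hx.2
  have hfull : ∀ S ⊆ boxI (n + 2), S ∩ Set.Iic top = S := fun S hS =>
    Set.inter_eq_left.2 (hS.trans hle)
  have hK := vol_boxI_inter_Iic hmem
  have hA := vol_prismLower_inter_Iic hd hmem
  have hB := vol_prismUpper_inter_Iic hd hmem
  rw [hfull _ subset_rfl] at hK
  rw [hfull _ fun _ h => h.1] at hA hB
  rw [eight_meanL2sq_of_two_unit_strata hbox (by rw [hK]; simp [htop])
    (measurableSet_prismLower hd) (measurableSet_prismUpper hd)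
    (by rw [hA]; norm_num [htop]) (by rw [hB]; norm_num [htop]) fun x hx => ?_]
  · refine setIntegral_congr_fun hbox fun x hx => ?_
    simp only [vol_boxI_inter_Iic hx, vol_prismLower_inter_Iic hd hx,
      vol_prismUpper_inter_Iic hd hx, Finset.prod_pow]
    ring
  · rw [vol_boxI_inter_Iic hx, vol_prismLower_inter_Iic hd hx, vol_prismUpper_inter_Iic hd hx]
    ring

lemma eight_meanL2sq_prism (hd : 2 ≤ n + 2) :
    8 * meanL2sq (boxI (n + 2)) ![prismLower (n + 2) hd, prismUpper (n + 2) hd] =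
      (1 / 2) ^ n - 3 / 5 * (1 / 3) ^ n := by
  have h1 : ∫ t in Set.Icc (0 : ℝ) 1, t = 1 / 2 := by
    rw [integral_Icc_eq_integral_Ioc, ← intervalIntegral.integral_of_le zero_le_one, integral_id]
    norm_num
  have h2 : ∫ t in Set.Icc (0 : ℝ) 1, t ^ 2 = 1 / 3 := by
    rw [integral_Icc_eq_integral_Ioc, ← intervalIntegral.integral_of_le zero_le_one, integral_pow]
    norm_num
  have hint : ∀ f : (Fin (n + 2) → ℝ) → ℝ, Continuous f → IntegrableOn f (boxI (n + 2)) :=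
    fun f hf => hf.integrableOn_Icc
  rw [eight_meanL2sq_prism_eq_integral hd,
    integral_add (hint _ (by fun_prop)) (hint _ (by fun_prop)), boxI_eq_preimage,
    setIntegral_splitTwo_preimage _ _ (fun a b => a * b) fun t => t,
    setIntegral_splitTwo_preimage _ _ (fun a b => -(a * b) ^ 2
      + 2 * (a * b) * max 0 (a / 2 + b - 1) ^ 2 - 2 * (max 0 (a / 2 + b - 1) ^ 2) ^ 2)
      fun t => t ^ 2,
    integral_bilinear_part, integral_quadratic_part, h1, h2]
  ring

end Prisms

/-- For `d ≥ 2` and the prism partition of `I = [0,2] × [0,1]^{d−1}`, one has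
`8 · E L2²(P_{Ω_\}) = 4·2^{−d} − (27/5)·3^{−d}`. -/
theorem eight_meanL2sq_prism_partition (d : ℕ) (hd : 2 ≤ d) :
    8 * meanL2sq (boxI d) ![prismLower d hd, prismUpper d hd] =
      4 * ((2 : ℝ) ^ d)⁻¹ - (27 / 5) * ((3 : ℝ) ^ d)⁻¹ := by
  obtain ⟨n, rfl⟩ := Nat.exists_eq_add_of_le' hd
  rw [eight_meanL2sq_prism]
  simp only [one_div, inv_pow, pow_add, mul_inv]
  ring

end StratifiedSampling
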